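/- arXiv:2509.11623 — 7 statements merged into one kernel-verified Lean document; each statement's English description precedes it below -/
import Mathlib

section
/- Let a, b be elements of a lattice L with a ⋖ b, and suppose d ∈ L is the relative pseudocomplement b → a. If c is a join-prime element of L with c ≤ b and ¬(c ≤ a), then (c, d) is a splitting pair in L; moreover c ≤ b and a ≤ d (so b lies in the up-set of c and a lies in the down-set of d). -/
/-- A pair `(c, d)` of elements of a lattice is a *splitting pair* if every `x`
satisfies exactly one of `c ≤ x` and `x ≤ d`. -/
def IsSplittingPair {L : Type*} [Preorder L] (c d : L) : Prop :=
  ∀ x : L, (c ≤ x ∨ x ≤ d) ∧ ¬(c ≤ x ∧ x ≤ d)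

/-- An element `c` of a lattice is *join-prime* if it is not a least element and
`c ≤ x ⊔ y` implies `c ≤ x` or `c ≤ y`. -/
def IsJoinPrime {L : Type*} [SemilatticeSup L] (c : L) : Prop :=
  (¬ ∀ y : L, c ≤ y) ∧ ∀ x y : L, c ≤ x ⊔ y → c ≤ x ∨ c ≤ y

/-- Lemma 2.6 (Lemma `lem:main`): let `a ⋖ b` in a lattice `L`, let `d` be the relative
pseudocomplement `b → a`, and let `c` be join-prime with `c ≤ b` and `¬ c ≤ a`.
Then `(c, d)` is a splitting pair with `b ∈ ↑c` and `a ∈ ↓d`. -/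
theorem splitting_pair_of_joinPrime {L : Type*} [Lattice L] (a b c d : L)
    (hab : a ⋖ b) (hd : ∀ x : L, x ⊓ b ≤ a ↔ x ≤ d)
    (hc : IsJoinPrime c) (hcb : c ≤ b) (hca : ¬ c ≤ a) :
    IsSplittingPair c d ∧ c ≤ b ∧ a ≤ d := by
  refine ⟨fun x => ⟨?_, fun h => hca ((le_inf h.1 hcb).trans ((hd x).2 h.2))⟩, hcb,
    (hd a).1 inf_le_left⟩
  by_cases hx : x ⊓ b ≤ a
  · exact Or.inr ((hd x).1 hx)
  · have hsup : a ⊔ x ⊓ b = b :=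
      (hab.eq_or_eq le_sup_left (sup_le hab.le inf_le_right)).resolve_left
        fun h => hx (sup_eq_left.1 h)
    exact Or.inl (((hc.2 a (x ⊓ b) (hcb.trans_eq hsup.symm)).resolve_left hca).trans inf_le_left)
end

section
/- Let a, b be elements of a lattice L with a ⋖ b, and suppose the relative pseudocomplement b → a exists in L. Then there is at most one join-prime element c of L with c ≤ b and ¬(c ≤ a); moreover, any such c is necessarily completely join-prime, in the sense that for every subset S of L whose supremum exists in L, c ≤ sup S implies c ≤ s for some s ∈ S. -/
/-- If `a ⋖ b` and `d` is the relative pseudocomplement `b → a`, then a join-prime `c ≤ b` with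
`¬ c ≤ a` splits the lattice into the elements above `c` and those below `d`. -/
theorem IsJoinPrime.le_iff_not_le_of_covBy {L : Type*} [Lattice L] {a b c d x : L}
    (hc : IsJoinPrime c) (hab : a ⋖ b) (hd : ∀ x : L, x ⊓ b ≤ a ↔ x ≤ d)
    (hcb : c ≤ b) (hca : ¬ c ≤ a) : c ≤ x ↔ ¬ x ≤ d := by
  constructor
  · intro hcx hxd
    exact hca ((le_inf hcx hcb).trans ((hd x).2 hxd))
  · intro hxd
    have hsup : a ⊔ x ⊓ b = b :=
      (hab.eq_or_eq le_sup_left (sup_le hab.le inf_le_right)).resolve_left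
        fun h => hxd ((hd x).1 (sup_eq_left.1 h))
    exact ((hc.2 a (x ⊓ b) (hcb.trans hsup.ge)).resolve_left hca).trans inf_le_left

/-- Corollary 2.7 (Corollary `cor:uniquejp`): let `a ⋖ b` in a lattice `L` and suppose
the relative pseudocomplement `b → a` exists. Then there is at most one join-prime
element `c` with `c ≤ b` and `¬ c ≤ a`, and any such `c` is completely join-prime:
for every subset `S` whose supremum exists, `c ≤ sup S` implies `c ≤ s` for some
`s ∈ S`. -/
theorem unique_joinPrime_of_covby {L : Type*} [Lattice L] (a b d : L)
    (hab : a ⋖ b) (hd : ∀ x : L, x ⊓ b ≤ a ↔ x ≤ d) :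
    (∀ c₁ c₂ : L,
        IsJoinPrime c₁ → c₁ ≤ b → ¬ c₁ ≤ a →
        IsJoinPrime c₂ → c₂ ≤ b → ¬ c₂ ≤ a → c₁ = c₂) ∧
    (∀ c : L, IsJoinPrime c → c ≤ b → ¬ c ≤ a →
        ∀ (S : Set L) (s : L), IsLUB S s → c ≤ s → ∃ x ∈ S, c ≤ x) := by
  have key : ∀ c : L, IsJoinPrime c → c ≤ b → ¬ c ≤ a → ∀ x : L, c ≤ x ↔ ¬ x ≤ d :=
    fun c hc hcb hca x => hc.le_iff_not_le_of_covBy hab hd hcb hca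
  refine ⟨fun c₁ c₂ h₁ h₁b h₁a h₂ h₂b h₂a => ?_, fun c hc hcb hca S s hS hcs => ?_⟩
  · exact eq_of_forall_ge_iff fun x => (key c₁ h₁ h₁b h₁a x).trans (key c₂ h₂ h₂b h₂a x).symm
  · by_contra! h
    exact (key c hc hcb hca s).1 hcs
      (hS.2 fun x hx => not_not.1 fun hxd => h x hx ((key c hc hcb hca x).2 hxd))
end

section
/- Let L be a Heyting algebra in which the join-irreducible elements are join-dense, i.e. whenever ¬(u ≤ v) in L there exists a join-irreducible element j with j ≤ u and ¬(j ≤ v). Then for all a, b ∈ L with a ⋖ b there exists a splitting pair (c, d) in L with c ≤ b and a ≤ d. -/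
/-- An element `j` of a lattice with bottom is *join-irreducible* if `j ≠ ⊥` and
`j = x ⊔ y` implies `j = x` or `j = y`. -/
def IsJoinIrreducible {L : Type*} [SemilatticeSup L] [OrderBot L] (j : L) : Prop :=
  j ≠ ⊥ ∧ ∀ x y : L, j = x ⊔ y → j = x ∨ j = y

/-- In a Heyting algebra a join-irreducible element is join-prime. -/
theorem IsJoinIrreducible.le_or_le {L : Type*} [HeytingAlgebra L] {j x y : L}
    (hj : IsJoinIrreducible j) (h : j ≤ x ⊔ y) : j ≤ x ∨ j ≤ y := by
  have hsup : j = j ⊓ x ⊔ j ⊓ y := by rw [← inf_sup_left, inf_eq_left.mpr h]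
  exact (hj.2 _ _ hsup).imp left_eq_inf.mp left_eq_inf.mp

/-- Theorem 2.8 (Theorem `thm:Heyt-cov2splitting`): let `L` be a Heyting algebra in
which the join-irreducible elements are join-dense.  For all `a ⋖ b` in `L` there is
a splitting pair `(c, d)` with `b ∈ ↑c` and `a ∈ ↓d`. -/
theorem exists_splitting_pair_of_covby {L : Type*} [HeytingAlgebra L]
    (hdense : ∀ u v : L, ¬ u ≤ v →
      ∃ j : L, IsJoinIrreducible j ∧ j ≤ u ∧ ¬ j ≤ v) :
    ∀ a b : L, a ⋖ b →
      ∃ c d : L, IsSplittingPair c d ∧ c ≤ b ∧ a ≤ d := by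
  intro a b hab
  obtain ⟨j, hj, hjb, hja⟩ := hdense b a hab.lt.not_ge
  refine ⟨j, b ⇨ a, fun x => ⟨?_, ?_⟩, hjb, le_himp⟩
  · rw [le_himp_iff]
    rcases hab.eq_or_eq le_sup_left (sup_le hab.le (inf_le_right : x ⊓ b ≤ b)) with h | h
    · exact Or.inr (sup_eq_left.mp h)
    · exact Or.inl (((hj.le_or_le (hjb.trans_eq h.symm)).resolve_left hja).trans inf_le_left)
  · rintro ⟨hjx, hxd⟩
    exact hja ((le_inf hjx hjb).trans (le_himp_iff.mp hxd))
end

section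
/- Let L be a lattice with a least element in which every element is the supremum of a finite set of join-prime elements. Then all dual relative pseudocomplements exist in L: for all a, b ∈ L there exists c ∈ L such that for all x ∈ L, b ≤ x ⊔ a if and only if c ≤ x. -/
/-- Lemma 2.9 (Lemma `lem:dualrelpseudocomps`): let `L` be a lattice with a least
element in which every element is the join of a finite set of join-prime elements.
Then all dual relative pseudocomplements exist in `L`: for all `a b` there is `c`
such that for all `x`, `b ≤ x ⊔ a ↔ c ≤ x`. -/
theorem exists_dual_relpseudo {L : Type*} [Lattice L] [OrderBot L]
    (h : ∀ a : L, ∃ F : Finset L,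
      (∀ c ∈ F, IsJoinPrime c) ∧ a = F.sup id) :
    ∀ a b : L, ∃ c : L, ∀ x : L, b ≤ x ⊔ a ↔ c ≤ x := by
  classical
  intro a b
  obtain ⟨F, hF, rfl⟩ := h b
  refine ⟨(F.filter fun p => ¬ p ≤ a).sup id, fun x => ?_⟩
  simp only [Finset.sup_le_iff, Finset.mem_filter, id_eq, and_imp]
  refine ⟨fun hx p hp hpa => ((hF p hp).2 x a (hx p hp)).resolve_right hpa,
    fun hx p hp => ?_⟩
  by_cases hpa : p ≤ a
  · exact le_sup_of_le_right hpa
  · exact le_sup_of_le_left (hx p hp hpa)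
end

section
/- Let a, b be elements of a lattice L with a ⋖ b, and suppose both the dual relative pseudocomplement c := b ∸ a and the relative pseudocomplement d := b → a exist in L. Then (c, d) is a splitting pair in L with c ≤ b and a ≤ d. In particular, c is completely join-prime and d is completely meet-prime, in the sense that for every subset S of L whose supremum exists, c ≤ sup S implies c ≤ s for some s ∈ S, and dually for d with infima. -/
theorem IsSplittingPair.exists_le_of_isLUB {L : Type*} [Preorder L] {c d : L}
    (h : IsSplittingPair c d) {S : Set L} {s : L} (hs : IsLUB S s) (hcs : c ≤ s) :
    ∃ x ∈ S, c ≤ x := by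
  by_contra! hS
  exact (h s).2 ⟨hcs, hs.2 fun x hx => (h x).1.resolve_left (hS x hx)⟩

theorem IsSplittingPair.exists_le_of_isGLB {L : Type*} [Preorder L] {c d : L}
    (h : IsSplittingPair c d) {S : Set L} {s : L} (hs : IsGLB S s) (hsd : s ≤ d) :
    ∃ x ∈ S, x ≤ d := by
  by_contra! hS
  exact (h s).2 ⟨hs.2 fun x hx => (h x).1.resolve_right (hS x hx), hsd⟩

/-- Lemma 2.10 (Lemma `lem:altmain`): let `a ⋖ b` in a lattice `L` and suppose both
the dual relative pseudocomplement `c := b ∸ a` and the relative pseudocomplement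
`d := b → a` exist.  Then `(c, d)` is a splitting pair with `c ≤ b` and `a ≤ d`;
in particular `c` is completely join-prime and `d` is completely meet-prime. -/
theorem splitting_pair_of_relpseudo_pair {L : Type*} [Lattice L] (a b c d : L)
    (hab : a ⋖ b)
    (hc : ∀ x : L, b ≤ x ⊔ a ↔ c ≤ x)
    (hd : ∀ x : L, x ⊓ b ≤ a ↔ x ≤ d) :
    IsSplittingPair c d ∧ c ≤ b ∧ a ≤ d ∧
      (∀ (S : Set L) (s : L), IsLUB S s → c ≤ s → ∃ x ∈ S, c ≤ x) ∧
      (∀ (S : Set L) (s : L), IsGLB S s → s ≤ d → ∃ x ∈ S, x ≤ d) := by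
  have hcb : c ≤ b := (hc b).1 le_sup_left
  have had : a ≤ d := (hd a).1 inf_le_left
  have hsplit : IsSplittingPair c d := by
    refine fun x => ⟨?_, fun ⟨hcx, hxd⟩ => ?_⟩
    · by_cases hx : x ⊓ b ≤ a
      · exact Or.inr ((hd x).1 hx)
      · refine Or.inl ((hc x).1 ?_)
        rcases hab.eq_or_eq le_sup_right (sup_le inf_le_right hab.le : x ⊓ b ⊔ a ≤ b) with h | h
        · exact absurd (sup_eq_right.1 h) hx
        · exact h.ge.trans (sup_le_sup_right inf_le_left a)
    · have hca : c ≤ a := (le_inf (hcx.trans hxd) hcb).trans ((hd d).2 le_rfl)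
      exact hab.lt.not_ge (((hc a).2 hca).trans (sup_le le_rfl le_rfl))
  exact ⟨hsplit, hcb, had, fun _ _ => hsplit.exists_le_of_isLUB,
    fun _ _ => hsplit.exists_le_of_isGLB⟩
end

section
/- Let L be a double Heyting algebra (biheyting algebra), let u < v in L, and let a, b ∈ [u, v] with a covered by b. Then the pair ((b \ a) ⊔ u, (b ⇨ a) ⊓ v) is a splitting pair of the interval [u, v]: every x ∈ L with u ≤ x ≤ v satisfies exactly one of (b \ a) ⊔ u ≤ x and x ≤ (b ⇨ a) ⊓ v; moreover (b \ a) ⊔ u ≤ b and a ≤ (b ⇨ a) ⊓ v. -/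
/-- Corollary 2.12 (Corollary `cor:intervals`) for double Heyting algebras: if
`u < v` in a biheyting algebra `L` and `a ⋖ b` with `a, b ∈ [u, v]`, then
`((b \ a) ⊔ u, (b ⇨ a) ⊓ v)` is a splitting pair of the interval `[u, v]`:
every `x` with `u ≤ x ≤ v` satisfies exactly one of `(b \ a) ⊔ u ≤ x` and
`x ≤ (b ⇨ a) ⊓ v`; moreover `(b \ a) ⊔ u ≤ b` and `a ≤ (b ⇨ a) ⊓ v`. -/
theorem splitting_pair_interval_biheyting {L : Type*} [BiheytingAlgebra L]
    (u v a b : L) (huv : u < v)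
    (hua : u ≤ a) (hav : a ≤ v) (hub : u ≤ b) (hbv : b ≤ v)
    (hab : a ⋖ b) :
    (∀ x : L, u ≤ x → x ≤ v →
      ((b \ a ⊔ u ≤ x ∨ x ≤ (b ⇨ a) ⊓ v) ∧
        ¬(b \ a ⊔ u ≤ x ∧ x ≤ (b ⇨ a) ⊓ v))) ∧
    b \ a ⊔ u ≤ b ∧ a ≤ (b ⇨ a) ⊓ v := by
  refine ⟨fun x hux hxv => ⟨?_, ?_⟩, sup_le sdiff_le hub, le_inf le_himp hav⟩
  · rcases hab.eq_or_eq (le_sup_left : a ≤ a ⊔ x ⊓ b) (sup_le hab.le inf_le_right) with h | h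
    · exact Or.inr (le_inf (le_himp_iff.2 (sup_eq_left.1 h)) hxv)
    · refine Or.inl (sup_le (sdiff_le_iff.2 ?_) hux)
      exact h.ge.trans (sup_le_sup_left inf_le_left a)
  · rintro ⟨h₁, h₂⟩
    have hb : b ≤ a ⊔ x := sdiff_le_iff.1 (le_sup_left.trans h₁)
    have hx : x ⊓ b ≤ a := le_himp_iff.1 (h₂.trans inf_le_left)
    refine hab.lt.not_ge ?_
    calc b ≤ (a ⊔ x) ⊓ b := le_inf hb le_rfl
      _ = a ⊓ b ⊔ x ⊓ b := inf_sup_right a x b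
      _ ≤ a := sup_le inf_le_left hx
end

section
/- Let X be an ordered set, let U be a nonempty up-set of X, and let n ∈ ℕ. Then (↓↑)ⁿ(X ∖ (↑↓)ⁿ⁺¹U) ≠ X; equivalently, the set X ∖ (↓↑)ⁿ(X ∖ (↑↓)ⁿ⁺¹U) is nonempty. (In a dually pseudocomplemented Heyting algebra of up-sets this says that δⁿσⁿ⁺¹U ≠ ∅ for every nonempty up-set U, where σU = ∼¬U and δU = ¬∼U.) -/
/-- `upSet S = ↑S = {y | ∃ s ∈ S, s ≤ y}`. -/
def upSet {X : Type*} [Preorder X] (S : Set X) : Set X := {y | ∃ s ∈ S, s ≤ y}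

/-- `downSet S = ↓S = {y | ∃ s ∈ S, y ≤ s}`. -/
def downSet {X : Type*} [Preorder X] (S : Set X) : Set X := {y | ∃ s ∈ S, y ≤ s}

theorem subset_upSet {X : Type*} [Preorder X] (S : Set X) : S ⊆ upSet S :=
  fun x hx => ⟨x, hx, le_rfl⟩

theorem subset_downSet {X : Type*} [Preorder X] (S : Set X) : S ⊆ downSet S :=
  fun x hx => ⟨x, hx, le_rfl⟩

theorem upSet_upSet {X : Type*} [Preorder X] (S : Set X) : upSet (upSet S) = upSet S := by
  refine (subset_upSet _).antisymm' ?_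
  rintro x ⟨y, ⟨z, hz, hzy⟩, hyx⟩
  exact ⟨z, hz, hzy.trans hyx⟩

/-- A zigzag from `S` to a point of the up-set `U`, traversed backwards, leads from `U` to a
point of `S`. -/
theorem exists_mem_upDown_iter_of_mem_downUp_iter {X : Type*} [Preorder X] {S : Set X} {x : X}
    (n : ℕ) {U : Set X} (hU : upSet U = U) (hxU : x ∈ U)
    (hx : x ∈ (fun S => downSet (upSet S))^[n] S) :
    ∃ c ∈ S, c ∈ (fun S => upSet (downSet S))^[n + 1] U := by
  induction n generalizing U x with
  | zero => exact ⟨x, hx, subset_upSet _ (subset_downSet _ hxU)⟩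
  | succ n ih =>
    rw [Function.iterate_succ_apply'] at hx
    obtain ⟨a, ⟨b, hb, hba⟩, hxa⟩ := hx
    have ha : a ∈ U := hU ▸ ⟨x, hxU, hxa⟩
    rw [Function.iterate_succ_apply]
    exact ih (upSet_upSet _) (subset_upSet _ ⟨a, ha, hba⟩) hb

/-- Lemma 6.8 (Lemma `dq-counting`), order-theoretic form: for any ordered set `X`,
any nonempty up-set `U` and any `n`, we have `(↓↑)ⁿ(X ∖ (↑↓)ⁿ⁺¹U) ≠ X`.
(In the dual algebra of up-sets this says `δⁿσⁿ⁺¹U ≠ ∅`, where `σU = ∼¬U`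
and `δU = ¬∼U`.) -/
theorem downUp_iter_compl_ne_univ {X : Type*} [PartialOrder X]
    (U : Set X) (hU : upSet U = U) (hne : U.Nonempty) (n : ℕ) :
    (fun S => downSet (upSet S))^[n]
        (((fun S => upSet (downSet S))^[n + 1] U)ᶜ) ≠ Set.univ := by
  intro h
  obtain ⟨u, hu⟩ := hne
  obtain ⟨c, hc, hc'⟩ := exists_mem_upDown_iter_of_mem_downUp_iter n hU hu
    (h.symm ▸ Set.mem_univ u)
  exact hc hc'
end
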